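/- (Corollary 4: Conway circle for tangential quadrilaterals.) Let V₁, V₂, V₃, V₄ be the vertices (in cyclic order) of a convex tangential quadrilateral with incenter I and inradius r > 0, with side lengths a = dist V₁ V₂, b = dist V₂ V₃, c = dist V₃ V₄, d = dist V₄ V₁. Let d₀ = dist V₁ T, where T is the orthogonal projection of I onto the line through V₄ and V₁ (the tangency point of the incircle on the side of length d). Extend both sides through V₁ beyond V₁ by length b + d - d₀, both sides through V₂ beyond V₂ by c + d₀, both sides through V₃ beyond V₃ by a + d - d₀, and both sides through V₄ beyond V₄ by b + d₀ (so, e.g., at V₁ one forms V₁ + ((b + d - d₀)/a) • (V₁ - V₂) and V₁ + ((b + d - d₀)/d) • (V₁ - V₄)). Then the resulting eight points are all equidistant from I, i.e., they lie on a common circle centered at the quadrilateral's incenter. -/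

import Mathlib

noncomputable section

/-- The Euclidean plane. -/
abbrev Pt : Type := EuclideanSpace ℝ (Fin 2)

/-- A side `PQ` of a polygon is tangent to the circle of center `I`, radius `r`,
at a point strictly between `P` and `Q`. -/
def TangentSide (I : Pt) (r : ℝ) (P Q : Pt) : Prop :=
  (∃ T : Pt, Sbtw ℝ P T Q ∧ dist I T = r) ∧
    Metric.infDist I (affineSpan ℝ {P, Q} : Set Pt) = r

open EuclideanGeometry in
theorem dist_sq_eq_add_of_dist_eq_infDist {L : AffineSubspace ℝ Pt} {I T X : Pt}
    (hT : T ∈ L) (hIT : dist I T = Metric.infDist I (L : Set Pt)) (hX : X ∈ L) :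
    dist I X ^ 2 = dist I T ^ 2 + dist X T ^ 2 := by
  have : Nonempty L := ⟨⟨T, hT⟩⟩
  have key : ∀ Y ∈ L, dist I Y ^ 2 =
      dist I T ^ 2 + dist Y (orthogonalProjection L I : Pt) ^ 2 := by
    intro Y hY
    have h := dist_sq_eq_dist_orthogonalProjection_sq_add_dist_orthogonalProjection_sq
      (s := L) I hY
    have h' := dist_orthogonalProjection_eq_infDist L I
    rw [dist_comm I Y, hIT, ← h']
    linarith
  have hproj : T = (orthogonalProjection L I : Pt) := by
    have h := key T hT
    exact dist_eq_zero.mp (pow_eq_zero_iff two_ne_zero |>.mp (by linarith))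
  have h := key X hX
  rwa [← hproj] at h

namespace TangentSide

variable {I P Q : Pt} {r : ℝ}

theorem symm (h : TangentSide I r P Q) : TangentSide I r Q P := by
  obtain ⟨⟨T, hT, hIT⟩, hinf⟩ := h
  exact ⟨⟨T, hT.symm, hIT⟩, by rwa [Set.pair_comm]⟩

theorem dist_left_eq_sqrt (h : TangentSide I r P Q) {T : Pt}
    (hT : T ∈ affineSpan ℝ {P, Q}) (hIT : dist I T = r) :
    dist P T = √(dist I P ^ 2 - r ^ 2) := by
  have h' := dist_sq_eq_add_of_dist_eq_infDist hT (hIT.trans h.2.symm)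
    (left_mem_affineSpan_pair ℝ P Q)
  rw [h', hIT, add_sub_cancel_left, Real.sqrt_sq dist_nonneg]

theorem dist_eq_sqrt_add_sqrt (h : TangentSide I r P Q) :
    dist P Q = √(dist I P ^ 2 - r ^ 2) + √(dist I Q ^ 2 - r ^ 2) := by
  obtain ⟨T, hT, hIT⟩ := h.1
  rw [← h.dist_left_eq_sqrt hT.wbtw.mem_affineSpan hIT,
    ← h.symm.dist_left_eq_sqrt hT.symm.wbtw.mem_affineSpan hIT, dist_comm Q T,
    hT.wbtw.dist_add_dist]

/-- The distance from the center to the point obtained by extending the side `QP` beyond `P`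
by the signed length `x`. -/
theorem dist_extension (h : TangentSide I r P Q) (hPQ : P ≠ Q) (x : ℝ) :
    dist I (P + (x / dist P Q) • (P - Q)) =
      √(r ^ 2 + (x + √(dist I P ^ 2 - r ^ 2)) ^ 2) := by
  obtain ⟨T, hT, hIT⟩ := h.1
  have hTL := hT.wbtw.mem_affineSpan
  have hXL : P + (x / dist P Q) • (P - Q) ∈ affineSpan ℝ {P, Q} := by
    have := AffineMap.lineMap_mem_affineSpan_pair (-(x / dist P Q)) P Q
    convert this using 1
    simp only [AffineMap.lineMap_apply, vsub_eq_sub, vadd_eq_add]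
    module
  have hsq := dist_sq_eq_add_of_dist_eq_infDist hTL (hIT.trans h.2.symm) hXL
  have hXT : dist (P + (x / dist P Q) • (P - Q)) T ^ 2 = (x + dist P T) ^ 2 := by
    obtain ⟨t, ⟨ht, -⟩, rfl⟩ := hT.wbtw
    have hD : dist P Q ≠ 0 := dist_ne_zero.mpr hPQ
    rw [dist_left_lineMap, Real.norm_of_nonneg ht, dist_eq_norm,
      show P + (x / dist P Q) • (P - Q) - AffineMap.lineMap P Q t =
        (x / dist P Q + t) • (P - Q) by
        simp only [AffineMap.lineMap_apply, vsub_eq_sub, vadd_eq_add]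
        module,
      norm_smul, ← dist_eq_norm, mul_pow, Real.norm_eq_abs, sq_abs, ← mul_pow]
    congr 1
    field_simp
  rw [← h.dist_left_eq_sqrt hTL hIT, ← hXT, ← hIT, ← hsq, Real.sqrt_sq dist_nonneg]

end TangentSide

/-- **Corollary 4: Conway circle for tangential quadrilaterals.**
For a convex tangential quadrilateral `V₁V₂V₃V₄` with side lengths
`a, b, c, d` and `d₀` the distance from `V₁` to the tangency point `T` on the
side of length `d`, extending both sides through `V₁, V₂, V₃, V₄` by
`b + d - d₀, c + d₀, a + d - d₀, b + d₀` respectively yields eight points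
equidistant from the incenter `I`. -/
theorem conway_circle_quadrilateral
    (V1 V2 V3 V4 I : Pt) (r : ℝ) (hr : 0 < r)
    (h12 : V1 ≠ V2) (h23 : V2 ≠ V3) (h34 : V3 ≠ V4) (h41 : V4 ≠ V1)
    (ht12 : TangentSide I r V1 V2) (ht23 : TangentSide I r V2 V3)
    (ht34 : TangentSide I r V3 V4) (ht41 : TangentSide I r V4 V1)
    (hc12 : (affineSpan ℝ {V1, V2}).SSameSide I V3 ∧
      (affineSpan ℝ {V1, V2}).SSameSide I V4)
    (hc23 : (affineSpan ℝ {V2, V3}).SSameSide I V4 ∧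
      (affineSpan ℝ {V2, V3}).SSameSide I V1)
    (hc34 : (affineSpan ℝ {V3, V4}).SSameSide I V1 ∧
      (affineSpan ℝ {V3, V4}).SSameSide I V2)
    (hc41 : (affineSpan ℝ {V4, V1}).SSameSide I V2 ∧
      (affineSpan ℝ {V4, V1}).SSameSide I V3)
    (a b c d : ℝ)
    (ha : a = dist V1 V2) (hb : b = dist V2 V3) (hc : c = dist V3 V4)
    (hd : d = dist V4 V1)
    (T : Pt) (hT : T ∈ affineSpan ℝ ({V4, V1} : Set Pt)) (hTr : dist I T = r)
    (d0 : ℝ) (hd0 : d0 = dist V1 T) :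
    ∃ ρ : ℝ,
      dist I (V1 + ((b + d - d0) / a) • (V1 - V2)) = ρ ∧
      dist I (V1 + ((b + d - d0) / d) • (V1 - V4)) = ρ ∧
      dist I (V2 + ((c + d0) / a) • (V2 - V1)) = ρ ∧
      dist I (V2 + ((c + d0) / b) • (V2 - V3)) = ρ ∧
      dist I (V3 + ((a + d - d0) / b) • (V3 - V2)) = ρ ∧
      dist I (V3 + ((a + d - d0) / c) • (V3 - V4)) = ρ ∧
      dist I (V4 + ((b + d0) / c) • (V4 - V3)) = ρ ∧
      dist I (V4 + ((b + d0) / d) • (V4 - V1)) = ρ := by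
  set x := fun V : Pt => √(dist I V ^ 2 - r ^ 2)
  have hx : d0 = x V1 := hd0.trans <|
    ht41.symm.dist_left_eq_sqrt (by rwa [Set.pair_comm]) hTr
  have hax : a = x V1 + x V2 := ha.trans ht12.dist_eq_sqrt_add_sqrt
  have hbx : b = x V2 + x V3 := hb.trans ht23.dist_eq_sqrt_add_sqrt
  have hcx : c = x V3 + x V4 := hc.trans ht34.dist_eq_sqrt_add_sqrt
  have hdx : d = x V4 + x V1 := hd.trans ht41.dist_eq_sqrt_add_sqrt
  have extension {P Q : Pt} {e l : ℝ} (h : TangentSide I r P Q) (hPQ : P ≠ Q)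
      (hl : l = dist P Q) (he : e + x P = x V1 + x V2 + x V3 + x V4) :
      dist I (P + (e / l) • (P - Q)) = √(r ^ 2 + (x V1 + x V2 + x V3 + x V4) ^ 2) := by
    rw [hl, h.dist_extension hPQ, ← he]
  refine ⟨√(r ^ 2 + (x V1 + x V2 + x V3 + x V4) ^ 2),
    extension ht12 h12 ha ?_,
    extension ht41.symm h41.symm (hd.trans (dist_comm _ _)) ?_,
    extension ht12.symm h12.symm (ha.trans (dist_comm _ _)) ?_,
    extension ht23 h23 hb ?_,
    extension ht23.symm h23.symm (hb.trans (dist_comm _ _)) ?_,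
    extension ht34 h34 hc ?_,
    extension ht34.symm h34.symm (hc.trans (dist_comm _ _)) ?_,
    extension ht41 h41 hd ?_⟩ <;> linarith
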